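/- Assume 24·n·log(n) ≤ s. Then, in expectation over a sample S of size s drawn i.i.d. from p, E_S[sup_{X ∈ W_p̌} (L_p(X) − L̂_S(X))] ≤ E_S[sup_{X ∈ 2·W_p̃} (L_p(X) − L̂_S(X))] + 8·√(l²·r·n·m)/n², and likewise E_S[sup_{X ∈ W_p̌} (L̂_S(X) − L_p(X))] ≤ E_S[sup_{X ∈ 2·W_p̃} (L̂_S(X) − L_p(X))] + 8·√(l²·r·n·m)/n², where 2·W_p̃ = {X : ‖X‖_tr(p̃) ≤ 2√r}. -/

import Mathlib

open scoped Classical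
open Matrix Finset

noncomputable section

/-- Trace norm (sum of singular values) of a real matrix. -/
def traceNorm {n m : ℕ} (X : Matrix (Fin n) (Fin m) ℝ) : ℝ :=
  ∑ j, Real.sqrt ((Matrix.isHermitian_conjTranspose_mul_self X).eigenvalues j)

/-- Weighted trace norm with row weights `pr` and column weights `pc`. -/
def wTrNorm {n m : ℕ} (pr : Fin n → ℝ) (pc : Fin m → ℝ)
    (X : Matrix (Fin n) (Fin m) ℝ) : ℝ :=
  traceNorm (Matrix.diagonal (fun i => Real.sqrt (pr i)) * X *
    Matrix.diagonal (fun j => Real.sqrt (pc j)))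

/-- Weighted trace-norm ball of radius `√r`. -/
def Wball {n m : ℕ} (pr : Fin n → ℝ) (pc : Fin m → ℝ) (r : ℝ) :
    Set (Matrix (Fin n) (Fin m) ℝ) :=
  {X | wTrNorm pr pc X ≤ Real.sqrt r}

/-- Row marginals of a distribution on `[n] × [m]`. -/
def rowMarg {n m : ℕ} (p : Matrix (Fin n) (Fin m) ℝ) (i : Fin n) : ℝ := ∑ j, p i j

/-- Column marginals of a distribution on `[n] × [m]`. -/
def colMarg {n m : ℕ} (p : Matrix (Fin n) (Fin m) ℝ) (j : Fin m) : ℝ := ∑ i, p i j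

/-- `p` is a probability distribution on `[n] × [m]`. -/
def IsDistrib {n m : ℕ} (p : Matrix (Fin n) (Fin m) ℝ) : Prop :=
  (∀ i j, 0 ≤ p i j) ∧ ∑ i, ∑ j, p i j = 1

/-- `ℓ` is `l`-Lipschitz in its first argument. -/
def LipLoss (l : ℝ) (ℓ : ℝ → ℝ → ℝ) : Prop :=
  ∀ x x' y, |ℓ x y - ℓ x' y| ≤ l * |x - x'|

/-- Probability of drawing the i.i.d. sample `S` from `p`. -/
def sampleProb {n m s : ℕ} (p : Matrix (Fin n) (Fin m) ℝ)
    (S : Fin s → Fin n × Fin m) : ℝ :=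
  ∏ t, p (S t).1 (S t).2

/-- Expectation over an i.i.d. sample of size `s` drawn from `p`. -/
def Esample {n m : ℕ} (s : ℕ) (p : Matrix (Fin n) (Fin m) ℝ)
    (f : (Fin s → Fin n × Fin m) → ℝ) : ℝ :=
  ∑ S : Fin s → Fin n × Fin m, sampleProb p S * f S

/-- Empirical risk of `X` on the sample `S` (target matrix `Y`, loss `ℓ`). -/
def empRisk {n m s : ℕ} (ℓ : ℝ → ℝ → ℝ) (Y : Matrix (Fin n) (Fin m) ℝ)
    (S : Fin s → Fin n × Fin m) (X : Matrix (Fin n) (Fin m) ℝ) : ℝ :=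
  (1 / (s : ℝ)) * ∑ t, ℓ (X (S t).1 (S t).2) (Y (S t).1 (S t).2)

/-- Population risk of `X` under sampling distribution `p`. -/
def popRisk {n m : ℕ} (p : Matrix (Fin n) (Fin m) ℝ) (ℓ : ℝ → ℝ → ℝ)
    (Y X : Matrix (Fin n) (Fin m) ℝ) : ℝ :=
  ∑ i, ∑ j, p i j * ℓ (X i j) (Y i j)

/-- Smoothed row marginals: `p̃^r(i) = p^r(i)/2 + 1/(2n)`. -/
def smoothR {n m : ℕ} (p : Matrix (Fin n) (Fin m) ℝ) (i : Fin n) : ℝ :=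
  rowMarg p i / 2 + 1 / (2 * (n : ℝ))

/-- Smoothed column marginals: `p̃^c(j) = p^c(j)/2 + 1/(2m)`. -/
def smoothC {n m : ℕ} (p : Matrix (Fin n) (Fin m) ℝ) (j : Fin m) : ℝ :=
  colMarg p j / 2 + 1 / (2 * (m : ℝ))

/-- Empirical row marginals of the sample `S`: `p̂^r(i) = #{t : i_t = i}/s`. -/
def empRowMarg {n m s : ℕ} (S : Fin s → Fin n × Fin m) (i : Fin n) : ℝ :=
  ((Finset.univ.filter fun t => (S t).1 = i).card : ℝ) / (s : ℝ)

/-- Empirical column marginals of the sample `S`: `p̂^c(j) = #{t : j_t = j}/s`. -/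
def empColMarg {n m s : ℕ} (S : Fin s → Fin n × Fin m) (j : Fin m) : ℝ :=
  ((Finset.univ.filter fun t => (S t).2 = j).card : ℝ) / (s : ℝ)

/-- Smoothed empirical row marginals: `p̌^r(i) = (p̂^r(i) + 1/n)/2`. -/
def checkR {n m s : ℕ} (S : Fin s → Fin n × Fin m) (i : Fin n) : ℝ :=
  (empRowMarg S i + 1 / (n : ℝ)) / 2

/-- Smoothed empirical column marginals: `p̌^c(j) = (p̂^c(j) + 1/m)/2`. -/
def checkC {n m s : ℕ} (S : Fin s → Fin n × Fin m) (j : Fin m) : ℝ :=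
  (empColMarg S j + 1 / (m : ℝ)) / 2


theorem svd_aux {n m : ℕ} (X : Matrix (Fin n) (Fin m) ℝ) :
    ∃ (A : Matrix (Fin n) (Fin m) ℝ) (U : Matrix (Fin m) (Fin m) ℝ) (σ : Fin m → ℝ),
      (∀ k, 0 ≤ σ k) ∧ Aᵀ * A = diagonal (fun k => σ k ^ 2) ∧ Uᵀ * U = 1 ∧ U * Uᵀ = 1 ∧
      A = X * U ∧ X = A * Uᵀ ∧ traceNorm X = ∑ k, σ k := by
  set h := Matrix.isHermitian_conjTranspose_mul_self X with hh
  set U : Matrix (Fin m) (Fin m) ℝ := (h.eigenvectorUnitary : Matrix (Fin m) (Fin m) ℝ) with hU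
  have hnn : ∀ k, 0 ≤ h.eigenvalues k := fun k =>
    (Matrix.posSemidef_conjTranspose_mul_self X).eigenvalues_nonneg k
  have hU1 : Uᵀ * U = 1 := by
    have := Unitary.coe_star_mul_self h.eigenvectorUnitary
    rwa [Matrix.star_eq_conjTranspose, Matrix.conjTranspose_eq_transpose_of_trivial] at this
  have hU2 : U * Uᵀ = 1 := by
    exact mul_eq_one_comm.mp hU1
  refine ⟨X * U, U, fun k => Real.sqrt (h.eigenvalues k), fun k => Real.sqrt_nonneg _, ?_, hU1, hU2,
    rfl, ?_, rfl⟩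
  · have hs := h.spectral_theorem
    have hs' : Xᵀ * X = U * diagonal (h.eigenvalues) * Uᵀ := by
      rw [Unitary.conjStarAlgAut_apply] at hs
      rw [← Matrix.conjTranspose_eq_transpose_of_trivial X]
      refine hs.trans ?_
      rw [← hU, Matrix.star_eq_conjTranspose, Matrix.conjTranspose_eq_transpose_of_trivial U]
      rfl
    simp only [Real.sq_sqrt (hnn _)]
    calc (X * U)ᵀ * (X * U) = Uᵀ * (Xᵀ * X) * U := by
          rw [Matrix.transpose_mul]; simp only [Matrix.mul_assoc]
      _ = (Uᵀ * U) * diagonal (h.eigenvalues) * (Uᵀ * U) := by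
          rw [hs']; simp only [Matrix.mul_assoc]
      _ = _ := by rw [hU1]; simp
  · rw [Matrix.mul_assoc, hU2, Matrix.mul_one]

/-- Bessel -/
theorem bessel_aux {n m : ℕ} (W : Matrix (Fin n) (Fin m) ℝ) (d : Fin m → ℝ)
    (hd : ∀ k, d k ≤ 1)
    (hW : Wᵀ * W = diagonal d) (a : Fin n → ℝ) :
    ∑ k, (∑ i, W i k * a i) ^ 2 ≤ ∑ i, a i ^ 2 := by
  set c : Fin m → ℝ := fun k => ∑ i, W i k * a i with hc
  have hc' : c = Wᵀ *ᵥ a := by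
    ext k; simp [hc, Matrix.mulVec, dotProduct]
  have h0 : 0 ≤ (a - W *ᵥ c) ⬝ᵥ (a - W *ᵥ c) := by
    rw [dotProduct]; exact Finset.sum_nonneg fun i _ => mul_self_nonneg _
  have h1 : a ⬝ᵥ (W *ᵥ c) = c ⬝ᵥ c := by
    rw [Matrix.dotProduct_mulVec, ← Matrix.mulVec_transpose, ← hc']
  have h2 : (W *ᵥ c) ⬝ᵥ (W *ᵥ c) = ∑ k, d k * c k ^ 2 := by
    rw [Matrix.dotProduct_mulVec, ← Matrix.mulVec_transpose, Matrix.mulVec_mulVec, hW]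
    simp [Matrix.mulVec_diagonal, dotProduct]
    exact Finset.sum_congr rfl fun k _ => by ring
  have h3 : ∑ k, d k * c k ^ 2 ≤ ∑ k, c k ^ 2 :=
    Finset.sum_le_sum fun k _ => by nlinarith [hd k, sq_nonneg (c k)]
  have h4 : c ⬝ᵥ c = ∑ k, c k ^ 2 := by simp [dotProduct, sq]
  have h5 : a ⬝ᵥ a = ∑ k, a k ^ 2 := by simp [dotProduct, sq]
  rw [sub_dotProduct, dotProduct_sub, dotProduct_sub, dotProduct_comm (W *ᵥ c) a, h1, h2, h4, h5] at h0
  linarith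

theorem tr_le {n m K : ℕ} (a : Fin K → Fin n → ℝ) (b : Fin K → Fin m → ℝ)
    (Z : Matrix (Fin n) (Fin m) ℝ) (hZ : ∀ i j, Z i j = ∑ t, a t i * b t j) :
    traceNorm Z ≤ ∑ t, Real.sqrt (∑ i, a t i ^ 2) * Real.sqrt (∑ j, b t j ^ 2) := by
  obtain ⟨A, U, σ, hσ, hA, hU, hU', hAZ, hZA, htr⟩ := svd_aux Z
  rw [htr]
  set W : Matrix (Fin n) (Fin m) ℝ := A * diagonal (fun k => (σ k)⁻¹) with hWdef
  have hW : Wᵀ * W = diagonal (fun k => (σ k)⁻¹ * σ k ^ 2 * (σ k)⁻¹) := by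
    rw [hWdef, Matrix.transpose_mul, Matrix.diagonal_transpose]
    calc _ = diagonal (fun k => (σ k)⁻¹) * (Aᵀ * A) * diagonal (fun k => (σ k)⁻¹) := by
          simp only [Matrix.mul_assoc]
      _ = _ := by rw [hA]; simp
  have hd : ∀ k, (σ k)⁻¹ * σ k ^ 2 * (σ k)⁻¹ ≤ 1 := by
    intro k
    by_cases h : σ k = 0
    · simp [h]
    · field_simp; exact le_rfl
  have hWA : Wᵀ * A = diagonal σ := by
    rw [hWdef, Matrix.transpose_mul, Matrix.diagonal_transpose, Matrix.mul_assoc, hA]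
    rw [diagonal_mul_diagonal]
    congr 1; ext k
    by_cases h : σ k = 0
    · simp [h]
    · field_simp
  have hσe : ∀ k, σ k = ∑ t, (∑ i, W i k * a t i) * (∑ j, U j k * b t j) := by
    intro k
    have h1 : σ k = (Wᵀ * (Z * U)) k k := by rw [← hAZ, hWA]; simp
    rw [h1]
    simp only [Matrix.mul_apply, Matrix.transpose_apply, hZ, Finset.sum_mul, Finset.mul_sum]
    rw [Finset.sum_comm' (t' := univ) (s' := fun _ => univ) (by simp)]
    rw [Finset.sum_congr rfl (fun _ _ => Finset.sum_comm)]
    rw [Finset.sum_comm]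
    refine Finset.sum_congr rfl fun t _ => ?_
    refine Finset.sum_congr rfl fun i _ => Finset.sum_congr rfl fun j _ => by ring
  have : ∑ k, σ k = ∑ t, ∑ k, (∑ i, W i k * a t i) * (∑ j, U j k * b t j) := by
    rw [Finset.sum_comm]; exact Finset.sum_congr rfl fun k _ => hσe k
  rw [this]
  refine Finset.sum_le_sum fun t _ => ?_
  refine (Real.sum_mul_le_sqrt_mul_sqrt _ _ _).trans ?_
  refine mul_le_mul (Real.sqrt_le_sqrt (bessel_aux W _ hd hW _))
    (Real.sqrt_le_sqrt (bessel_aux U (fun _ => 1) (fun _ => le_rfl) (by rw [hU]; simp) _))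
    (Real.sqrt_nonneg _) (Real.sqrt_nonneg _)

theorem decomp {n m : ℕ} (X : Matrix (Fin n) (Fin m) ℝ) :
    ∃ (a : Fin m → Fin n → ℝ) (b : Fin m → Fin m → ℝ) ,
      (∀ i j, X i j = ∑ t, a t i * b t j) ∧ (∀ t, ∑ j, b t j ^ 2 = 1) ∧
      traceNorm X = ∑ t, Real.sqrt (∑ i, a t i ^ 2) := by
  obtain ⟨A, U, σ, hσ, hA, hU, hU', hAZ, hZA, htr⟩ := svd_aux X
  refine ⟨fun t i => A i t, fun t j => U j t, ?_, ?_, ?_⟩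
  · intro i j
    conv_lhs => rw [hZA]
    simp [Matrix.mul_apply]
  · intro t
    have := congrFun (congrFun hU t) t
    simpa [Matrix.mul_apply, sq] using this
  · rw [htr]
    refine Finset.sum_congr rfl fun t _ => ?_
    have := congrFun (congrFun hA t) t
    simp [Matrix.mul_apply, ← sq] at this
    rw [this, Real.sqrt_sq (hσ t)]

theorem abs_le_sqrt_sum {n : ℕ} (a : Fin n → ℝ) (i : Fin n) : |a i| ≤ Real.sqrt (∑ i, a i ^ 2) :=
  Real.abs_le_sqrt (Finset.single_le_sum (f := fun i => a i ^ 2) (fun _ _ => sq_nonneg _) (mem_univ i))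

theorem entry_le_tr {n m : ℕ} (X : Matrix (Fin n) (Fin m) ℝ) (i j) : |X i j| ≤ traceNorm X := by
  obtain ⟨a, b, h, hb, ht⟩ := decomp X
  rw [ht, h]
  refine (Finset.abs_sum_le_sum_abs _ _).trans (Finset.sum_le_sum fun t _ => ?_)
  have h2 := abs_le_sqrt_sum (b t) j
  rw [hb, Real.sqrt_one] at h2
  rw [abs_mul]
  nlinarith [abs_le_sqrt_sum (a t) i, abs_nonneg (a t i), abs_nonneg (b t j)]

theorem sqrt_scale {n : ℕ} (c : ℝ) (hc : 0 ≤ c) (d a : Fin n → ℝ) (hd : ∀ i, d i ^ 2 ≤ c ^ 2) :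
    Real.sqrt (∑ i, (d i * a i) ^ 2) ≤ c * Real.sqrt (∑ i, a i ^ 2) := by
  have hcc : c * Real.sqrt (∑ i, a i ^ 2) = Real.sqrt (c ^ 2 * ∑ i, a i ^ 2) := by
    rw [Real.sqrt_mul (sq_nonneg _), Real.sqrt_sq hc]
  rw [hcc, Finset.mul_sum]
  refine Real.sqrt_le_sqrt (Finset.sum_le_sum fun i _ => ?_)
  rw [mul_pow]
  exact mul_le_mul_of_nonneg_right (hd i) (sq_nonneg _)

theorem tr_scale {n m : ℕ} (X Z : Matrix (Fin n) (Fin m) ℝ) (d : Fin n → ℝ) (e : Fin m → ℝ)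
    (c c' : ℝ) (hc : 0 ≤ c) (hc' : 0 ≤ c')
    (hd : ∀ i, d i ^ 2 ≤ c ^ 2) (he : ∀ i, e i ^ 2 ≤ c' ^ 2) (hZ : ∀ i j, Z i j = d i * X i j * e j) :
    traceNorm Z ≤ c * c' * traceNorm X := by
  obtain ⟨a, b, h, hb, ht⟩ := decomp X
  refine (tr_le (fun t i => d i * a t i) (fun t j => e j * b t j) Z ?_).trans ?_
  · intro i j
    rw [hZ, h, Finset.mul_sum, Finset.sum_mul]
    exact Finset.sum_congr rfl fun t _ => by ring
  · rw [ht, Finset.mul_sum]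
    refine Finset.sum_le_sum fun t _ => ?_
    have h1 := sqrt_scale c hc d (a t) hd
    have h2 := sqrt_scale c' hc' e (b t) he
    rw [hb, Real.sqrt_one, mul_one] at h2
    calc _ ≤ (c * Real.sqrt (∑ i, a t i ^ 2)) * c' :=
          mul_le_mul h1 h2 (Real.sqrt_nonneg _) (mul_nonneg hc (Real.sqrt_nonneg _))
      _ = _ := by ring

theorem tr_zero {n m : ℕ} : traceNorm (0 : Matrix (Fin n) (Fin m) ℝ) = 0 := by
  apply le_antisymm
  · refine (tr_le (K := 0) (fun t _ => 0) (fun t _ => 0) _ (by simp)).trans (by simp)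
  · exact Finset.sum_nonneg fun _ _ => Real.sqrt_nonneg _

theorem tr_nonneg {n m : ℕ} (X : Matrix (Fin n) (Fin m) ℝ) : 0 ≤ traceNorm X :=
  Finset.sum_nonneg fun _ _ => Real.sqrt_nonneg _

theorem chernoff {α : Type*} [Fintype α] (s : ℕ) (f : α → ℝ) (hf : ∀ a, 0 ≤ f a)
    (h1 : ∑ a, f a = 1) (P : α → Prop) [DecidablePred P] (q : ℝ) (hq : q = ∑ a, if P a then f a else 0) :
    ∑ S : Fin s → α, (∏ t, f (S t)) *
      (if ((Finset.univ.filter fun t => P (S t)).card : ℝ) < s * q / 2 then 1 else 0)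
      ≤ Real.exp (-(s * q / 8)) := by
  have hq0 : 0 ≤ q := by
    rw [hq]; exact Finset.sum_nonneg fun a _ => by split_ifs <;> simp [hf]
  have hq1 : q ≤ 1 := by
    rw [hq, ← h1]; exact Finset.sum_le_sum fun a _ => by split_ifs <;> simp [hf]
  have hsum : ∑ a, f a * (if P a then (1/2 : ℝ) else 1) = 1 - q / 2 := by
    have : ∀ a, f a * (if P a then (1/2 : ℝ) else 1) = f a - (if P a then f a else 0) / 2 := by
      intro a; split_ifs <;> ring
    rw [Finset.sum_congr rfl fun a _ => this a, Finset.sum_sub_distrib, ← Finset.sum_div, ← hq, h1]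
  have key : ∀ S : Fin s → α, (∏ t, f (S t)) *
      (if ((Finset.univ.filter fun t => P (S t)).card : ℝ) < s * q / 2 then 1 else 0) ≤
      (∏ t, f (S t) * (if P (S t) then (1/2 : ℝ) else 1)) * Real.exp (Real.log 2 * (s * q / 2)) := by
    intro S
    rw [Finset.prod_mul_distrib, mul_assoc]
    refine mul_le_mul_of_nonneg_left ?_ (Finset.prod_nonneg fun t _ => hf _)
    rw [Finset.prod_ite]
    simp only [Finset.prod_const, one_pow, mul_one]
    set N := (Finset.univ.filter fun t => P (S t)).card
    have hN : ((1/2 : ℝ)) ^ N = Real.exp (- (Real.log 2 * N)) := by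
      rw [Real.exp_neg, mul_comm, Real.exp_nat_mul, Real.exp_log (by norm_num)]; simp
    rw [hN, ← Real.exp_add]
    split_ifs with hlt
    · apply Real.one_le_exp
      nlinarith [Real.log_pos (show (1:ℝ) < 2 by norm_num)]
    · positivity
  refine (Finset.sum_le_sum fun S _ => key S).trans ?_
  rw [← Finset.sum_mul, ← Fintype.sum_pow (fun a => f a * (if P a then (1/2 : ℝ) else 1)) s, hsum]
  have h2 : (1 - q / 2) ^ s ≤ Real.exp (-(s * q / 2)) := by
    calc (1 - q/2)^s ≤ (Real.exp (-(q/2)))^s := by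
          apply pow_le_pow_left₀ (by linarith)
          have := Real.add_one_le_exp (-(q/2)); linarith
      _ = _ := by rw [← Real.exp_nat_mul]; congr 1; ring
  calc _ ≤ Real.exp (-(s * q / 2)) * Real.exp (Real.log 2 * (s * q / 2)) := by gcongr
    _ = Real.exp (-(s * q / 2) + Real.log 2 * (s * q / 2)) := by rw [Real.exp_add]
    _ ≤ _ := by
      apply Real.exp_le_exp.mpr
      have : 0 ≤ s * q := by positivity
      nlinarith [Real.log_two_lt_d9]

theorem entry_w {n m : ℕ} (hn : 0 < n) (hm : 0 < m) (pr : Fin n → ℝ) (pc : Fin m → ℝ)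
    (hpr : ∀ i, 1 / (2 * (n : ℝ)) ≤ pr i) (hpc : ∀ i, 1 / (2 * (m : ℝ)) ≤ pc i)
    (X : Matrix (Fin n) (Fin m) ℝ) (R : ℝ) (h : wTrNorm pr pc X ≤ R) (i j) :
    |X i j| ≤ R * (2 * Real.sqrt (n * m)) := by
  have h1 := (entry_le_tr _ i j).trans h
  rw [Matrix.mul_diagonal, Matrix.diagonal_mul, abs_mul, abs_mul, abs_of_nonneg (Real.sqrt_nonneg _),
    abs_of_nonneg (Real.sqrt_nonneg _)] at h1
  have hn' : (0:ℝ) < n := by exact_mod_cast hn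
  have hm' : (0:ℝ) < m := by exact_mod_cast hm
  have h2 : 1 ≤ (Real.sqrt (pr i) * Real.sqrt (pc j)) * (2 * Real.sqrt (n * m)) := by
    have e : (2:ℝ) * Real.sqrt (n * m) = Real.sqrt ((2 * n) * (2 * m)) := by
      rw [show (2 * (n:ℝ)) * (2 * m) = 2 ^ 2 * (n * m) by ring, Real.sqrt_mul (by positivity : (0:ℝ) ≤ 2 ^ 2) ((n:ℝ) * m),
        Real.sqrt_sq (by norm_num)]
    have p1 : 0 ≤ pr i := le_trans (by positivity) (hpr i)
    have p2 : 0 ≤ pc j := le_trans (by positivity) (hpc j)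
    rw [e, ← Real.sqrt_mul p1, ← Real.sqrt_mul (mul_nonneg p1 p2)]
    apply Real.one_le_sqrt.mpr
    have a1 : 1 ≤ pr i * (2 * n) := by
      have := hpr i; rwa [div_le_iff₀ (by positivity)] at this
    have a2 : 1 ≤ pc j * (2 * m) := by
      have := hpc j; rwa [div_le_iff₀ (by positivity)] at this
    nlinarith
  calc |X i j| = |X i j| * 1 := by ring
    _ ≤ |X i j| * ((Real.sqrt (pr i) * Real.sqrt (pc j)) * (2 * Real.sqrt (n * m))) :=
        mul_le_mul_of_nonneg_left h2 (abs_nonneg _)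
    _ = (Real.sqrt (pr i) * |X i j| * Real.sqrt (pc j)) * (2 * Real.sqrt (n * m)) := by ring
    _ ≤ _ := mul_le_mul_of_nonneg_right h1 (by positivity)

theorem ball_incl {n m : ℕ} (pr pr' : Fin n → ℝ) (pc pc' : Fin m → ℝ)
    (hpr : ∀ i, 0 < pr i) (hpc : ∀ i, 0 < pc i) (hpr0 : ∀ i, 0 ≤ pr' i) (hpc0 : ∀ i, 0 ≤ pc' i)
    (h1 : ∀ i, pr' i ≤ 2 * pr i) (h2 : ∀ i, pc' i ≤ 2 * pc i)
    (X : Matrix (Fin n) (Fin m) ℝ) : wTrNorm pr' pc' X ≤ 2 * wTrNorm pr pc X := by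
  have := tr_scale (Matrix.diagonal (fun i => Real.sqrt (pr i)) * X *
    Matrix.diagonal (fun j => Real.sqrt (pc j))) (Matrix.diagonal (fun i => Real.sqrt (pr' i)) * X *
    Matrix.diagonal (fun j => Real.sqrt (pc' j)))
    (fun i => Real.sqrt (pr' i) / Real.sqrt (pr i)) (fun i => Real.sqrt (pc' i) / Real.sqrt (pc i))
    (Real.sqrt 2) (Real.sqrt 2) (Real.sqrt_nonneg _) (Real.sqrt_nonneg _) ?_ ?_ ?_
  · rwa [Real.mul_self_sqrt (by norm_num)] at this
  · intro i
    rw [div_pow, Real.sq_sqrt (hpr0 i), Real.sq_sqrt (hpr i).le, Real.sq_sqrt (by norm_num),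
      div_le_iff₀ (hpr i)]
    exact h1 i
  · intro i
    rw [div_pow, Real.sq_sqrt (hpc0 i), Real.sq_sqrt (hpc i).le, Real.sq_sqrt (by norm_num),
      div_le_iff₀ (hpc i)]
    exact h2 i
  · intro i j
    simp only [Matrix.mul_diagonal, Matrix.diagonal_mul]
    have := (Real.sqrt_pos.mpr (hpr i)).ne'
    have := (Real.sqrt_pos.mpr (hpc j)).ne'
    field_simp

theorem wTr_zero {n m : ℕ} (pr : Fin n → ℝ) (pc : Fin m → ℝ) :
    wTrNorm pr pc (0 : Matrix (Fin n) (Fin m) ℝ) = 0 := by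
  rw [wTrNorm, Matrix.mul_zero, Matrix.zero_mul, tr_zero]

def badEv {n m s : ℕ} (p : Matrix (Fin n) (Fin m) ℝ) (S : Fin s → Fin n × Fin m) : Prop :=
  (∃ i, 1 / (n : ℝ) ≤ rowMarg p i ∧
    ((Finset.univ.filter fun t => (S t).1 = i).card : ℝ) < s * rowMarg p i / 2) ∨
  (∃ j, 1 / (n : ℝ) ≤ colMarg p j ∧
    ((Finset.univ.filter fun t => (S t).2 = j).card : ℝ) < s * colMarg p j / 2)

theorem exp_bd (n s : ℕ) (hn : 0 < n) (hs : 24 * (n : ℝ) * Real.log n ≤ (s : ℝ)) (q : ℝ)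
    (hq : 1 / (n : ℝ) ≤ q) : Real.exp (-(s * q / 8)) ≤ 1 / (n : ℝ) ^ 3 := by
  have hn' : (0:ℝ) < n := by exact_mod_cast hn
  have e : 1 / (n : ℝ) ^ 3 = Real.exp (-(3 * Real.log n)) := by
    rw [Real.exp_neg, show (3:ℝ) * Real.log n = (3:ℕ) * Real.log n by norm_num, Real.exp_nat_mul,
      Real.exp_log hn', one_div]
  rw [e]
  apply Real.exp_le_exp.mpr
  have : 24 * Real.log n ≤ s * q := by
    calc 24 * Real.log n = 24 * n * Real.log n * (1 / n) := by field_simp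
      _ ≤ s * (1 / n) := mul_le_mul_of_nonneg_right hs (by positivity)
      _ ≤ s * q := mul_le_mul_of_nonneg_left hq (by positivity)
  linarith

theorem sampleProb_nonneg {n m s : ℕ} (p : Matrix (Fin n) (Fin m) ℝ) (hp : IsDistrib p)
    (S : Fin s → Fin n × Fin m) : 0 ≤ sampleProb p S :=
  Finset.prod_nonneg fun _ _ => hp.1 _ _

theorem bad_prob {n m s : ℕ} (hn : 0 < n) (hnm : m ≤ n) (p : Matrix (Fin n) (Fin m) ℝ)
    (hp : IsDistrib p) (hs : 24 * (n : ℝ) * Real.log n ≤ (s : ℝ)) :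
    ∑ S : Fin s → Fin n × Fin m, sampleProb p S * (if badEv p S then 1 else 0)
      ≤ 2 / (n : ℝ) ^ 2 := by
  have hn' : (0:ℝ) < n := by exact_mod_cast hn
  have hnm' : (m:ℝ) ≤ n := by exact_mod_cast hnm
  set I : Fin n → (Fin s → Fin n × Fin m) → ℝ := fun i S =>
    if 1 / (n : ℝ) ≤ rowMarg p i ∧
      ((Finset.univ.filter fun t => (S t).1 = i).card : ℝ) < s * rowMarg p i / 2 then 1 else 0 with hI
  set J : Fin m → (Fin s → Fin n × Fin m) → ℝ := fun j S =>
    if 1 / (n : ℝ) ≤ colMarg p j ∧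
      ((Finset.univ.filter fun t => (S t).2 = j).card : ℝ) < s * colMarg p j / 2 then 1 else 0 with hJ
  have hI0 : ∀ i S, 0 ≤ I i S := fun i S => by simp only [hI]; split_ifs <;> norm_num
  have hJ0 : ∀ i S, 0 ≤ J i S := fun i S => by simp only [hJ]; split_ifs <;> norm_num
  have hsum : ∑ a : Fin n × Fin m, p a.1 a.2 = 1 := by
    rw [Fintype.sum_prod_type]; exact hp.2
  have hIE : ∀ i, ∑ S, sampleProb p S * I i S ≤ 1 / (n : ℝ) ^ 3 := by
    intro i
    by_cases h : 1 / (n : ℝ) ≤ rowMarg p i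
    · refine le_trans ?_ (exp_bd n s hn hs _ h)
      have := chernoff s (fun a : Fin n × Fin m => p a.1 a.2) (fun a => hp.1 _ _) hsum
        (fun a => a.1 = i) (rowMarg p i) (by
          rw [Fintype.sum_prod_type, rowMarg]
          rw [Finset.sum_eq_single i] <;> simp +contextual)
      simpa only [hI, h, true_and, sampleProb] using this
    · simp only [hI, h, false_and, if_false, mul_zero, Finset.sum_const_zero]
      positivity
  have hJE : ∀ j, ∑ S, sampleProb p S * J j S ≤ 1 / (n : ℝ) ^ 3 := by
    intro j
    by_cases h : 1 / (n : ℝ) ≤ colMarg p j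
    · refine le_trans ?_ (exp_bd n s hn hs _ h)
      have := chernoff s (fun a : Fin n × Fin m => p a.1 a.2) (fun a => hp.1 _ _) hsum
        (fun a => a.2 = j) (colMarg p j) (by
          rw [Fintype.sum_prod_type, colMarg]
          simp)
      simpa only [hJ, h, true_and, sampleProb] using this
    · simp only [hJ, h, false_and, if_false, mul_zero, Finset.sum_const_zero]
      positivity
  have hb : ∀ S, sampleProb p S * (if badEv p S then 1 else 0) ≤
      ∑ i, sampleProb p S * I i S + ∑ j, sampleProb p S * J j S := by
    intro S
    rw [← Finset.mul_sum, ← Finset.mul_sum, ← mul_add]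
    refine mul_le_mul_of_nonneg_left ?_ (sampleProb_nonneg p hp S)
    have s1 : 0 ≤ ∑ i, I i S := Finset.sum_nonneg fun i _ => hI0 i S
    have s2 : 0 ≤ ∑ i, J i S := Finset.sum_nonneg fun i _ => hJ0 i S
    split_ifs with h
    · rcases h with ⟨i, h⟩ | ⟨j, h⟩
      · have : I i S ≤ ∑ i, I i S := Finset.single_le_sum (f := fun i => I i S) (fun i _ => hI0 i S) (mem_univ i)
        have h1 : I i S = 1 := if_pos h
        linarith
      · have : J j S ≤ ∑ i, J i S := Finset.single_le_sum (f := fun i => J i S) (fun i _ => hJ0 i S) (mem_univ j)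
        have h1 : J j S = 1 := if_pos h
        linarith
    · linarith
  refine (Finset.sum_le_sum fun S _ => hb S).trans ?_
  rw [Finset.sum_add_distrib, Finset.sum_comm, Finset.sum_comm (s := univ) (t := (univ : Finset (Fin m)))]
  have t1 := Finset.sum_le_sum fun i (_ : i ∈ (univ : Finset (Fin n))) => hIE i
  have t2 := Finset.sum_le_sum fun i (_ : i ∈ (univ : Finset (Fin m))) => hJE i
  rw [Finset.sum_const, Finset.card_univ, Fintype.card_fin, nsmul_eq_mul] at t1 t2
  refine (add_le_add t1 t2).trans ?_
  calc (n:ℝ) * (1 / n ^ 3) + m * (1 / n ^ 3) ≤ (n:ℝ) * (1 / n ^ 3) + n * (1 / n ^ 3) := by gcongr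
    _ = _ := by field_simp; ring

theorem pop_diff {n m : ℕ} (p : Matrix (Fin n) (Fin m) ℝ) (ℓ : ℝ → ℝ → ℝ) (l : ℝ) (hl : 0 ≤ l)
    (Y X : Matrix (Fin n) (Fin m) ℝ) (hp : IsDistrib p) (hL : LipLoss l ℓ) (M : ℝ)
    (hX : ∀ i j, |X i j| ≤ M) : |popRisk p ℓ Y X - popRisk p ℓ Y 0| ≤ l * M := by
  have : l * M = ∑ i, ∑ j, p i j * (l * M) := by
    simp_rw [← Finset.sum_mul]; rw [hp.2, one_mul]
  rw [this, popRisk, popRisk, ← Finset.sum_sub_distrib]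
  refine (Finset.abs_sum_le_sum_abs _ _).trans (Finset.sum_le_sum fun i _ => ?_)
  rw [← Finset.sum_sub_distrib]
  refine (Finset.abs_sum_le_sum_abs _ _).trans (Finset.sum_le_sum fun j _ => ?_)
  rw [← mul_sub, abs_mul, abs_of_nonneg (hp.1 i j)]
  refine mul_le_mul_of_nonneg_left ((hL _ _ _).trans ?_) (hp.1 i j)
  rw [Matrix.zero_apply, sub_zero]
  exact mul_le_mul_of_nonneg_left (hX i j) hl

theorem emp_diff {n m s : ℕ} (hs : 0 < s) (S : Fin s → Fin n × Fin m) (ℓ : ℝ → ℝ → ℝ) (l : ℝ)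
    (hl : 0 ≤ l) (Y X : Matrix (Fin n) (Fin m) ℝ) (hL : LipLoss l ℓ) (M : ℝ)
    (hX : ∀ i j, |X i j| ≤ M) : |empRisk ℓ Y S X - empRisk ℓ Y S 0| ≤ l * M := by
  have hs' : (0:ℝ) < s := by exact_mod_cast hs
  rw [empRisk, empRisk, ← mul_sub, ← Finset.sum_sub_distrib, abs_mul, abs_of_nonneg (by positivity)]
  have : |∑ t, (ℓ (X (S t).1 (S t).2) (Y (S t).1 (S t).2) -
      ℓ ((0 : Matrix (Fin n) (Fin m) ℝ) (S t).1 (S t).2) (Y (S t).1 (S t).2))| ≤ ∑ t : Fin s, l * M := by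
    refine (Finset.abs_sum_le_sum_abs _ _).trans (Finset.sum_le_sum fun t _ => ?_)
    refine (hL _ _ _).trans ?_
    rw [Matrix.zero_apply, sub_zero]
    exact mul_le_mul_of_nonneg_left (hX _ _) hl
  rw [Finset.sum_const, Finset.card_univ, Fintype.card_fin, nsmul_eq_mul] at this
  rw [one_div, inv_mul_le_iff₀ hs']
  exact this

theorem good_row {s : ℕ} (hs : 0 < s) (N : ℕ) (q k n : ℝ) (hk : 0 < k) (hn : 0 < n) (hkn : k ≤ n)
    (h : ¬ (1 / n ≤ q ∧ (N : ℝ) < s * q / 2)) :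
    q / 2 + 1 / (2 * k) ≤ 2 * (((N : ℝ) / s + 1 / k) / 2) := by
  have hs' : (0:ℝ) < s := by exact_mod_cast hs
  have e : 1 / (2 * k) = (1 / k) / 2 := by field_simp
  have hk1 : 0 < 1 / k := by positivity
  have hN : 0 ≤ (N:ℝ) / s := by positivity
  rw [e]
  by_cases h1 : 1 / n ≤ q
  · have h2 : s * q / 2 ≤ N := by
      by_contra h3; exact h ⟨h1, not_le.mp h3⟩
    have : q / 2 ≤ (N:ℝ) / s := by
      rw [le_div_iff₀ hs']; linarith
    linarith
  · have := one_div_le_one_div_of_le hk hkn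
    linarith

theorem main_abs
    (n m s : ℕ) (r l : ℝ) (p : Matrix (Fin n) (Fin m) ℝ)
    (hm : 2 ≤ m) (hnm : m ≤ n) (hl : 0 ≤ l) (hs0 : 0 < s)
    (hp : IsDistrib p) 
    (hs : 24 * (n : ℝ) * Real.log n ≤ (s : ℝ))
    (F : (Fin s → Fin n × Fin m) → Matrix (Fin n) (Fin m) ℝ → ℝ)
    (hF : ∀ S X M, (∀ i j, |X i j| ≤ M) → |F S X - F S 0| ≤ 2 * (l * M)) :
    Esample s p (fun S => sSup ((fun X => F S X) '' Wball (checkR S) (checkC S) r)) ≤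
      Esample s p (fun S => sSup ((fun X => F S X) ''
          {X : Matrix (Fin n) (Fin m) ℝ |
            wTrNorm (smoothR p) (smoothC p) X ≤ 2 * Real.sqrt r})) +
        8 * Real.sqrt (l ^ 2 * r * n * m) / (n : ℝ) ^ 2 := by
  have hn0 : 0 < n := by omega
  have hm0 : 0 < m := by omega
  have hn' : (0:ℝ) < n := by exact_mod_cast hn0
  have hm' : (0:ℝ) < m := by exact_mod_cast hm0
  have hnm' : (m:ℝ) ≤ n := by exact_mod_cast hnm
  set C := Real.sqrt (l ^ 2 * r * n * m) with hC
  have hCe : l * (Real.sqrt r * Real.sqrt (n * m)) = C := by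
    rw [hC, show l ^ 2 * r * n * m = l ^ 2 * (r * (n * m)) by ring, Real.sqrt_mul (sq_nonneg l),
      Real.sqrt_sq hl, Real.sqrt_mul' r (by positivity : (0:ℝ) ≤ n * m)]
  have hsR : ∀ i, 1 / (2 * (n : ℝ)) ≤ smoothR p i := fun i => by
    have : 0 ≤ rowMarg p i := Finset.sum_nonneg fun j _ => hp.1 i j
    rw [smoothR]; linarith
  have hsC : ∀ j, 1 / (2 * (m : ℝ)) ≤ smoothC p j := fun j => by
    have : 0 ≤ colMarg p j := Finset.sum_nonneg fun i _ => hp.1 i j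
    rw [smoothC]; linarith
  have hcR : ∀ (S : Fin s → Fin n × Fin m) i, 1 / (2 * (n : ℝ)) ≤ checkR S i := fun S i => by
    have : 0 ≤ empRowMarg S i := by rw [empRowMarg]; positivity
    rw [checkR]
    have e : 1 / (2 * (n:ℝ)) = (1 / n) / 2 := by field_simp
    linarith
  have hcC : ∀ (S : Fin s → Fin n × Fin m) i, 1 / (2 * (m : ℝ)) ≤ checkC S i := fun S i => by
    have : 0 ≤ empColMarg S i := by rw [empColMarg]; positivity
    rw [checkC]
    have e : 1 / (2 * (m:ℝ)) = (1 / m) / 2 := by field_simp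
    linarith
  have pn : 0 < 1 / (2 * (n : ℝ)) := by positivity
  have pm : 0 < 1 / (2 * (m : ℝ)) := by positivity
  have pt : ∀ S : Fin s → Fin n × Fin m,
      sSup ((fun X => F S X) '' Wball (checkR S) (checkC S) r) ≤
      sSup ((fun X => F S X) '' {X : Matrix (Fin n) (Fin m) ℝ |
            wTrNorm (smoothR p) (smoothC p) X ≤ 2 * Real.sqrt r}) +
      4 * C * (if badEv p S then 1 else 0) := by
    intro S
    have bdd : BddAbove ((fun X => F S X) '' {X : Matrix (Fin n) (Fin m) ℝ |
            wTrNorm (smoothR p) (smoothC p) X ≤ 2 * Real.sqrt r}) := by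
      refine ⟨F S 0 + 2 * (l * (2 * Real.sqrt r * (2 * Real.sqrt (n * m)))), ?_⟩
      rintro _ ⟨X, hX, rfl⟩
      have := hF S X _ (entry_w hn0 hm0 _ _ hsR hsC X _ hX)
      have := (abs_le.mp this).2
      simp only; linarith
    apply csSup_le
    · exact ⟨_, 0, by rw [Wball, Set.mem_ofPred_eq, wTr_zero]; exact Real.sqrt_nonneg _, rfl⟩
    rintro _ ⟨X, hX, rfl⟩
    rw [Wball, Set.mem_ofPred_eq] at hX
    simp only
    split_ifs with hb
    · have h1 := hF S X _ (entry_w hn0 hm0 _ _ (hcR S) (hcC S) X _ hX)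
      have h2 := (abs_le.mp h1).2
      have h3 : F S 0 ≤ _ := le_csSup bdd ⟨0, by
        rw [Set.mem_ofPred_eq, wTr_zero]; positivity, rfl⟩
      have h4 : 2 * (l * (Real.sqrt r * (2 * Real.sqrt (n * m)))) = 4 * C := by rw [← hCe]; ring
      linarith
    · rw [mul_zero, add_zero]
      refine le_csSup bdd ⟨X, ?_, rfl⟩
      rw [Set.mem_ofPred_eq]
      have := ball_incl (checkR S) (smoothR p) (checkC S) (smoothC p)
        (fun i => pn.trans_le (hcR S i)) (fun i => pm.trans_le (hcC S i))
        (fun i => pn.le.trans (hsR i)) (fun i => pm.le.trans (hsC i))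
        (fun i => by
          rw [smoothR, checkR, empRowMarg]
          exact good_row hs0 _ _ n n hn' hn' le_rfl fun h => hb (Or.inl ⟨i, h⟩))
        (fun j => by
          rw [smoothC, checkC, empColMarg]
          exact good_row hs0 _ _ m n hm' hn' hnm' fun h => hb (Or.inr ⟨j, h⟩)) X
      linarith
  rw [Esample, Esample]
  have hC0 : 0 ≤ C := Real.sqrt_nonneg _
  calc _ ≤ ∑ S : Fin s → Fin n × Fin m, (sampleProb p S * sSup ((fun X => F S X) ''
          {X : Matrix (Fin n) (Fin m) ℝ |
            wTrNorm (smoothR p) (smoothC p) X ≤ 2 * Real.sqrt r}) +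
            4 * C * (sampleProb p S * (if badEv p S then 1 else 0))) := by
        refine Finset.sum_le_sum fun S _ => ?_
        refine (mul_le_mul_of_nonneg_left (pt S) (sampleProb_nonneg p hp S)).trans (le_of_eq ?_)
        ring
    _ ≤ _ := by
        rw [Finset.sum_add_distrib, ← Finset.mul_sum]
        have := mul_le_mul_of_nonneg_left (bad_prob hn0 hnm p hp hs) (show 0 ≤ 4 * C by positivity)
        have e : 4 * C * (2 / (n:ℝ) ^ 2) = 8 * C / (n:ℝ) ^ 2 := by ring
        linarith

/-- Lemma 1: if `24·n·log n ≤ s` then the expected uniform deviations over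
the smoothed empirically-weighted ball `W_p̌` are bounded by those over the doubled smoothed
ball `2·W_p̃` plus `8√(l² r n m)/n²`, in both directions. -/
theorem empirical_ball_deviation_comparison
    (n m s : ℕ) (r l : ℝ) (p : Matrix (Fin n) (Fin m) ℝ)
    (ℓ : ℝ → ℝ → ℝ) (Y : Matrix (Fin n) (Fin m) ℝ)
    (hm : 2 ≤ m) (hnm : m ≤ n) (hr : 1 ≤ r) (hl : 0 ≤ l)
    (hp : IsDistrib p) (hL : LipLoss l ℓ)
    (hs : 24 * (n : ℝ) * Real.log n ≤ (s : ℝ)) :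
    Esample s p (fun S =>
        sSup ((fun X => popRisk p ℓ Y X - empRisk ℓ Y S X) ''
          Wball (checkR S) (checkC S) r)) ≤
      Esample s p (fun S =>
        sSup ((fun X => popRisk p ℓ Y X - empRisk ℓ Y S X) ''
          {X : Matrix (Fin n) (Fin m) ℝ |
            wTrNorm (smoothR p) (smoothC p) X ≤ 2 * Real.sqrt r})) +
        8 * Real.sqrt (l ^ 2 * r * n * m) / (n : ℝ) ^ 2 ∧
    Esample s p (fun S =>
        sSup ((fun X => empRisk ℓ Y S X - popRisk p ℓ Y X) ''
          Wball (checkR S) (checkC S) r)) ≤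
      Esample s p (fun S =>
        sSup ((fun X => empRisk ℓ Y S X - popRisk p ℓ Y X) ''
          {X : Matrix (Fin n) (Fin m) ℝ |
            wTrNorm (smoothR p) (smoothC p) X ≤ 2 * Real.sqrt r})) +
        8 * Real.sqrt (l ^ 2 * r * n * m) / (n : ℝ) ^ 2 := by
  have hn2 : (1:ℝ) < n := by exact_mod_cast (by omega : 1 < n)
  have hs0 : 0 < s := by
    have : (0:ℝ) < s := lt_of_lt_of_le (by have := Real.log_pos hn2; positivity) hs
    exact_mod_cast this
  constructor
  · refine main_abs n m s r l p hm hnm hl hs0 hp hs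
      (fun S X => popRisk p ℓ Y X - empRisk ℓ Y S X) ?_
    intro S X M hX
    have h1 := abs_le.mp (pop_diff p ℓ l hl Y X hp hL M hX)
    have h2 := abs_le.mp (emp_diff hs0 S ℓ l hl Y X hL M hX)
    rw [abs_le]; constructor <;> linarith [h1.1, h1.2, h2.1, h2.2]
  · refine main_abs n m s r l p hm hnm hl hs0 hp hs
      (fun S X => empRisk ℓ Y S X - popRisk p ℓ Y X) ?_
    intro S X M hX
    have h1 := abs_le.mp (pop_diff p ℓ l hl Y X hp hL M hX)
    have h2 := abs_le.mp (emp_diff hs0 S ℓ l hl Y X hL M hX)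
    rw [abs_le]; constructor <;> linarith [h1.1, h1.2, h2.1, h2.2]


end
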